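/- (Non-degenerate maximal growth near the free boundary.) Let φ₋, φ₊ : ℝ^d → ℝ be non-constant C⁴, (2πℤ)^d-periodic functions with φ₊ − φ₋ ≥ τ everywhere for some τ > 0, assume max φ₋ > min φ₊, and assume ∇(Δφ±) ≠ 0 at every point of Γ± = (Δφ±)^{−1}(0). Let u be the unique continuous periodic solution of the double obstacle problem with contact sets M±(u), set d± = dist(Γ±, M±(u)) (which is > 0), and set L₋ = min{ −Δφ₋(x) : dist(x, M₋(u)) ≤ d₋/2 } > 0 and L₊ = min{ Δφ₊(x) : dist(x, M₊(u)) ≤ d₊/2 } > 0. Then there exists C₀ > 0 such that for every 0 < r ≤ 1/C₀: sup_{B(x₋,r)} (u − φ₋) ≥ r²·L₋/(3d) for every x₋ ∈ ∂M₋(u), and sup_{B(x₊,r)} (φ₊ − u) ≥ r²·L₊/(3d) for every x₊ ∈ ∂M₊(u). -/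

import Mathlib

open MeasureTheory Real

noncomputable section

/-- Euclidean space `ℝ^d`. -/
abbrev Rd (d : ℕ) := EuclideanSpace ℝ (Fin d)

/-- `f : ℝ^d → α` is `(2πℤ)^d`-periodic. -/
def PeriodicRd {d : ℕ} {α : Type*} (f : Rd d → α) : Prop :=
  ∀ (x : Rd d) (j : Fin d),
    f (x + (2 * Real.pi) • EuclideanSpace.single j (1 : ℝ)) = f x

/-- The Euclidean Laplacian `Δ = ∑ ∂²/∂xⱼ²`. -/
noncomputable def lapRd {d : ℕ} (f : Rd d → ℝ) (x : Rd d) : ℝ :=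
  ∑ j : Fin d,
    fderiv ℝ (fun y => fderiv ℝ f y (EuclideanSpace.single j (1 : ℝ))) x
      (EuclideanSpace.single j (1 : ℝ))

/-- The fundamental domain `E = [0,2π)^d`. -/
def EfdR (d : ℕ) : Set (Rd d) := {x | ∀ j : Fin d, x j ∈ Set.Ico 0 (2 * Real.pi)}

/-- `u` is a solution of the double obstacle problem with obstacles `φ₋ ≤ u ≤ φ₊`:
`u` is continuous, periodic, trapped between the obstacles, distributionally
subharmonic on `{u > φ₋}` and distributionally superharmonic on `{u < φ₊}`. -/
def IsDOPSolution {d : ℕ} (φm φp u : Rd d → ℝ) : Prop :=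
  Continuous u ∧ PeriodicRd u ∧ (∀ x, φm x ≤ u x ∧ u x ≤ φp x) ∧
    (∀ χ : Rd d → ℝ, ContDiff ℝ (⊤ : ℕ∞) χ → HasCompactSupport χ → (∀ x, 0 ≤ χ x) →
      tsupport χ ⊆ {x | φm x < u x} → 0 ≤ ∫ x : Rd d, u x * lapRd χ x) ∧
    (∀ χ : Rd d → ℝ, ContDiff ℝ (⊤ : ℕ∞) χ → HasCompactSupport χ → (∀ x, 0 ≤ χ x) →
      tsupport χ ⊆ {x | u x < φp x} → (∫ x : Rd d, u x * lapRd χ x) ≤ 0)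


open Metric Set Filter Topology

/-! ### The Laplacian of `C²` functions -/

section Laplacian

variable {d : ℕ}

lemma ContDiff.differentiable_fderiv_apply {f : Rd d → ℝ} (hf : ContDiff ℝ 2 f) (v : Rd d) :
    Differentiable ℝ fun y => fderiv ℝ f y v :=
  ((hf.fderiv_right (m := 1) (by norm_num)).clm_apply contDiff_const).differentiable (by norm_num)

lemma ContDiff.lapRd {n : WithTop ℕ∞} {f : Rd d → ℝ} (hf : ContDiff ℝ (n + 1 + 1) f) :
    ContDiff ℝ n (lapRd f) := by
  unfold _root_.lapRd
  refine ContDiff.sum fun j _ => ?_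
  have h1 : ContDiff ℝ (n + 1) fun y => fderiv ℝ f y (EuclideanSpace.single j (1 : ℝ)) :=
    (hf.fderiv_right le_rfl).clm_apply contDiff_const
  exact (h1.fderiv_right le_rfl).clm_apply contDiff_const

lemma ContDiff.continuous_lapRd {f : Rd d → ℝ} (hf : ContDiff ℝ 2 f) : Continuous (_root_.lapRd f) :=
  (ContDiff.lapRd (n := 0) (by simpa [one_add_one_eq_two] using hf)).continuous

lemma lapRd_add {f g : Rd d → ℝ} (hf : ContDiff ℝ 2 f) (hg : ContDiff ℝ 2 g) (x : Rd d) :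
    lapRd (fun y => f y + g y) x = lapRd f x + lapRd g x := by
  unfold lapRd
  rw [← Finset.sum_add_distrib]
  refine Finset.sum_congr rfl fun j _ => ?_
  have h : (fun y => fderiv ℝ (fun y => f y + g y) y (EuclideanSpace.single j (1 : ℝ))) =
      fun y => fderiv ℝ f y (EuclideanSpace.single j 1) +
        fderiv ℝ g y (EuclideanSpace.single j 1) := by
    funext y
    rw [fderiv_fun_add (hf.differentiable (by norm_num) y) (hg.differentiable (by norm_num) y)]
    rfl
  rw [h, fderiv_fun_add (hf.differentiable_fderiv_apply _ x) (hg.differentiable_fderiv_apply _ x)]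
  rfl

lemma lapRd_neg (f : Rd d → ℝ) (x : Rd d) : lapRd (fun y => -f y) x = -lapRd f x := by
  simp [lapRd, fderiv_fun_neg]

/-- A quadratic polynomial centred at `q`, singling out the direction `e`. -/
def quadraticTest (q e : Rd d) (a A B : ℝ) (y : Rd d) : ℝ :=
  a * inner ℝ (y - q) e + A * inner ℝ (y - q) e ^ 2 + B * ‖y - q‖ ^ 2

lemma contDiff_quadraticTest (q e : Rd d) (a A B : ℝ) {n : WithTop ℕ∞} :
    ContDiff ℝ n (quadraticTest q e a A B) := by
  unfold quadraticTest
  have h : ContDiff ℝ n fun y : Rd d => y - q := contDiff_id.sub contDiff_const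
  have h1 : ContDiff ℝ n fun y : Rd d => inner ℝ (y - q) e := h.inner ℝ contDiff_const
  exact ((contDiff_const.mul h1).add (contDiff_const.mul (h1.pow 2))).add
    (contDiff_const.mul (h.norm_sq ℝ))

lemma fderiv_quadraticTest (q e : Rd d) (a A B : ℝ) (y v : Rd d) :
    fderiv ℝ (quadraticTest q e a A B) y v =
      a * inner ℝ v e + A * (2 * inner ℝ (y - q) e * inner ℝ v e) +
        B * (2 * inner ℝ (y - q) v) := by
  have h : HasFDerivAt (fun y : Rd d => y - q) (ContinuousLinearMap.id ℝ (Rd d)) y :=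
    (hasFDerivAt_id y).sub_const q
  have h1 := h.inner ℝ (hasFDerivAt_const e y)
  have h2 := ((h1.const_mul a).add ((h1.pow 2).const_mul A)).add (h.norm_sq.const_mul B)
  have h3 : HasFDerivAt (quadraticTest q e a A B) _ y := h2
  rw [h3.fderiv]
  simp [fderivInnerCLM_apply, inner_sub_left]

lemma lapRd_quadraticTest (q e : Rd d) (a A B : ℝ) (y : Rd d) :
    lapRd (quadraticTest q e a A B) y = 2 * A * ‖e‖ ^ 2 + 2 * B * d := by
  unfold lapRd
  have h : ∀ j : Fin d, fderiv ℝ (fun y => fderiv ℝ (quadraticTest q e a A B) y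
      (EuclideanSpace.single j (1 : ℝ))) y (EuclideanSpace.single j (1 : ℝ)) =
      2 * A * e j ^ 2 + 2 * B := by
    intro j
    simp_rw [fderiv_quadraticTest]
    have h : HasFDerivAt (fun y : Rd d => y - q) (ContinuousLinearMap.id ℝ (Rd d)) y :=
      (hasFDerivAt_id y).sub_const q
    have h1 := h.inner ℝ (hasFDerivAt_const e y)
    have h2 := h.inner ℝ (hasFDerivAt_const (EuclideanSpace.single j (1 : ℝ)) y)
    rw [((((h1.const_mul 2).mul_const _).const_mul A).const_add _ |>.fun_add
      ((h2.const_mul 2).const_mul B)).fderiv]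
    simp [fderivInnerCLM_apply, EuclideanSpace.inner_single_left]
    ring
  simp_rw [h]
  rw [EuclideanSpace.norm_sq_eq, Finset.sum_add_distrib, ← Finset.mul_sum]
  simp
  ring

lemma IsLocalMax.lapRd_nonpos {f : Rd d → ℝ} {x : Rd d} (hf : ContDiff ℝ 2 f)
    (hx : IsLocalMax f x) : lapRd f x ≤ 0 := by
  refine Finset.sum_nonpos fun j _ => ?_
  set e : Rd d := EuclideanSpace.single j (1 : ℝ)
  have hl : ∀ t : ℝ, HasDerivAt (fun t : ℝ => x + t • e) e t := fun t => by
    simpa using ((hasDerivAt_id t).smul_const e).const_add x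
  have hg1 : deriv (fun t : ℝ => f (x + t • e)) = fun t => fderiv ℝ f (x + t • e) e := by
    funext t
    exact ((hf.differentiable (by norm_num) _).hasFDerivAt.comp_hasDerivAt t (hl t)).deriv
  have hg2 : deriv (deriv (fun t : ℝ => f (x + t • e))) 0 =
      fderiv ℝ (fun y => fderiv ℝ f y e) x e := by
    rw [hg1]
    have := ((hf.differentiable_fderiv_apply e (x + (0 : ℝ) • e)).hasFDerivAt.comp_hasDerivAt 0
      (hl 0)).deriv
    simpa [Function.comp_def] using this
  have hc : ContinuousAt (fun t : ℝ => x + t • e) 0 := (hl 0).continuousAt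
  have hmax : IsLocalMax (fun t : ℝ => f (x + t • e)) 0 := by
    have hx' : IsLocalMax f (x + (0 : ℝ) • e) := by simpa using hx
    exact hc.tendsto.eventually hx'
  by_contra! hpos
  rw [← hg2] at hpos
  have hmin := isLocalMin_of_deriv_deriv_pos hpos hmax.deriv_eq_zero
    ((hf.continuous.continuousAt).comp hc)
  have hconst : (fun t : ℝ => f (x + t • e)) =ᶠ[𝓝 0] fun _ => f (x + (0 : ℝ) • e) := by
    filter_upwards [hmax, hmin] with t h1 h2 using le_antisymm h1 h2
  have := hconst.deriv.deriv_eq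
  simp only [deriv_const', deriv_const] at this
  exact hpos.ne' this

lemma lapRd_periodic_shift {f : Rd d → ℝ} {v : Rd d} (hf : ∀ z, f (z + v) = f z) (x : Rd d) :
    lapRd f (x + v) = lapRd f x := by
  have h : (fun y => f (y + v)) = f := funext hf
  unfold lapRd
  refine Finset.sum_congr rfl fun j _ => ?_
  rw [← fderiv_comp_add_right]
  simp_rw [← fderiv_comp_add_right v, h]

end Laplacian

/-! ### Distributional subharmonicity implies viscosity subharmonicity -/

section Viscosity

variable {d : ℕ}

open ContinuousLinearMap (lsmul)
open scoped Convolution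

/-- `v` is distributionally subharmonic on `U`. -/
def WeakSubharmonicOn (v : Rd d → ℝ) (U : Set (Rd d)) : Prop :=
  ∀ χ : Rd d → ℝ, ContDiff ℝ (⊤ : ℕ∞) χ → HasCompactSupport χ → (∀ x, 0 ≤ χ x) →
    tsupport χ ⊆ U → 0 ≤ ∫ x : Rd d, v x * lapRd χ x

lemma fderiv_convolution_apply {f v : Rd d → ℝ} (hfc : HasCompactSupport f)
    (hf : ContDiff ℝ 1 f) (hv : Continuous v) (e y : Rd d) :
    fderiv ℝ (v ⋆[lsmul ℝ ℝ] f) y e = (v ⋆[lsmul ℝ ℝ] fun x => fderiv ℝ f x e) y := by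
  rw [(hfc.hasFDerivAt_convolution_right (lsmul ℝ ℝ) hv.locallyIntegrable hf y).fderiv]
  exact convolution_precompR_apply (lsmul ℝ ℝ) hv.locallyIntegrable (hfc.fderiv (𝕜 := ℝ))
    (hf.continuous_fderiv (by norm_num)) y e

lemma lapRd_convolution {f v : Rd d → ℝ} (hfc : HasCompactSupport f)
    (hf : ContDiff ℝ 2 f) (hv : Continuous v) (y : Rd d) :
    lapRd (v ⋆[lsmul ℝ ℝ] f) y = ∫ t, v t * lapRd f (y - t) := by
  have hfd : ∀ e : Rd d, ContDiff ℝ 1 fun x => fderiv ℝ f x e := fun e =>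
    (hf.fderiv_right (m := 1) (by norm_num)).clm_apply contDiff_const
  have hfcd : ∀ e : Rd d, HasCompactSupport fun x => fderiv ℝ f x e := fun e =>
    hfc.fderiv_apply (𝕜 := ℝ) e
  unfold lapRd
  simp_rw [fderiv_convolution_apply hfc (hf.of_le (by norm_num)) hv, Finset.mul_sum]
  rw [integral_finsetSum]
  · refine Finset.sum_congr rfl fun j _ => ?_
    exact fderiv_convolution_apply (hfcd _) (hfd _) hv _ y
  · intro j _
    exact ((hfcd _).fderiv_apply (𝕜 := ℝ) _).convolutionExists_right (lsmul ℝ ℝ)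
      hv.locallyIntegrable (((hfd _).continuous_fderiv (by norm_num)).clm_apply continuous_const) y

lemma lapRd_comp_const_sub (f : Rd d → ℝ) (y x : Rd d) :
    lapRd (fun t => f (y - t)) x = lapRd f (y - x) := by
  unfold lapRd
  refine Finset.sum_congr rfl fun j _ => ?_
  have h : ∀ g : Rd d → ℝ, ∀ x, fderiv ℝ (fun t => g (y - t)) x = -fderiv ℝ g (y - x) :=
    fun g x => by
    have h1 := (ContinuousLinearEquiv.neg ℝ (M := Rd d)).comp_right_fderiv
      (f := fun t => g (y + t)) (x := x)
    have h2 : (fun t => g (y - t)) =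
        (fun t => g (y + t)) ∘ (ContinuousLinearEquiv.neg ℝ (M := Rd d)) := by
      funext t
      simp [sub_eq_add_neg]
    rw [h2, h1, fderiv_comp_add_left]
    ext t
    simp [sub_eq_add_neg]
  simp_rw [h, _root_.neg_apply, fderiv_fun_neg, _root_.neg_apply]
  rw [h fun t => fderiv ℝ f t _]
  simp

/-- Mollification: a continuous weakly subharmonic function is, on a compact ball inside `U`,
uniformly close to `C²` functions with non-negative Laplacian. -/
lemma WeakSubharmonicOn.exists_contDiff_approx {v : Rd d → ℝ} {U : Set (Rd d)} (hv : Continuous v)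
    (h : WeakSubharmonicOn v U) {z : Rd d} {ρ R : ℝ} (hρR : ρ < R) (hU : closedBall z R ⊆ U)
    {η : ℝ} (hη : 0 < η) :
    ∃ g : Rd d → ℝ, ContDiff ℝ 2 g ∧ ∀ y ∈ closedBall z ρ, |g y - v y| ≤ η ∧ 0 ≤ lapRd g y := by
  obtain ⟨δ, hδ, hunif⟩ := Metric.uniformContinuousOn_iff.1
    ((isCompact_closedBall z R).uniformContinuousOn_of_continuous hv.continuousOn) η hη
  set s := min (δ / 2) (R - ρ) with hs
  have hs0 : 0 < s := lt_min (by linarith) (by linarith)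
  let b : ContDiffBump (0 : Rd d) := ⟨s / 2, s, by linarith, by linarith⟩
  set f := b.normed volume with hf
  have hfs : ContDiff ℝ (⊤ : ℕ∞) f := b.contDiff_normed
  have hfc : HasCompactSupport f := b.hasCompactSupport_normed
  refine ⟨v ⋆[lsmul ℝ ℝ] f, hfc.contDiff_convolution_right _ hv.locallyIntegrable
    (b.contDiff_normed (n := 2)), fun y hy => ⟨?_, ?_⟩⟩
  · have hcomm : v ⋆[lsmul ℝ ℝ] f = f ⋆[lsmul ℝ ℝ] v := by
      rw [← convolution_flip]
      congr 1
      ext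
      simp
    rw [hcomm, ← Real.dist_eq]
    refine b.dist_normed_convolution_le hv.aestronglyMeasurable fun x hx => ?_
    have hxy : dist x y < s := hx
    have hyz : dist y z ≤ ρ := hy
    refine (hunif x ?_ y ?_ ?_).le
    · rw [mem_closedBall]
      linarith [dist_triangle x y z, min_le_right (δ / 2) (R - ρ)]
    · exact closedBall_subset_closedBall hρR.le hy
    · linarith [min_le_left (δ / 2) (R - ρ)]
  · rw [lapRd_convolution hfc (b.contDiff_normed (n := 2)) hv]
    simp_rw [← lapRd_comp_const_sub]
    have hsupp : tsupport (fun t => f (y - t)) ⊆ closedBall y s := by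
      refine closure_minimal ?_ isClosed_closedBall
      intro t ht
      have : y - t ∈ Function.support f := ht
      rw [b.support_normed_eq, mem_ball_zero_iff] at this
      rw [mem_closedBall, dist_comm, dist_eq_norm]
      exact this.le
    refine h _ (hfs.comp (contDiff_const.sub contDiff_id)) ?_ (fun t => b.nonneg_normed _) ?_
    · exact (isCompact_closedBall y s).of_isClosed_subset (isClosed_tsupport _) hsupp
    · refine hsupp.trans (subset_trans ?_ hU)
      refine closedBall_subset_closedBall' ?_
      have hyz : dist y z ≤ ρ := hy
      linarith [min_le_right (δ / 2) (R - ρ)]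

/-- If a `C²` function touches a weakly subharmonic function from above, then its Laplacian
is non-negative at the point of contact. -/
lemma WeakSubharmonicOn.lapRd_nonneg_of_isLocalMax {v θ : Rd d → ℝ} {U : Set (Rd d)}
    (hv : Continuous v) (h : WeakSubharmonicOn v U) (hU : IsOpen U) {z : Rd d} (hz : z ∈ U)
    (hθ : ContDiff ℝ 2 θ) (hmax : IsLocalMax (fun y => v y - θ y) z) : 0 ≤ lapRd θ z := by
  by_contra! hneg
  obtain ⟨ε, hε, hεd⟩ : ∃ ε : ℝ, 0 < ε ∧ lapRd θ z + 2 * ε * d < 0 := by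
    refine ⟨-lapRd θ z / (2 * (d + 1)), div_pos (by linarith) (by positivity), ?_⟩
    have : (0 : ℝ) < d + 1 := by positivity
    have h1 : -lapRd θ z / (2 * (d + 1)) * (2 * (d + 1)) = -lapRd θ z :=
      div_mul_cancel₀ _ (by positivity)
    have h2 : 0 < -lapRd θ z / (2 * (d + 1)) := div_pos (by linarith) (by positivity)
    linarith
  set θ' : Rd d → ℝ := fun y => θ y + quadraticTest z 0 0 0 ε y with hθ'
  have hθ'c : ContDiff ℝ 2 θ' := hθ.add (contDiff_quadraticTest ..)
  have hlap : ∀ y, lapRd θ' y = lapRd θ y + 2 * ε * d := fun y => by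
    rw [hθ', lapRd_add hθ (contDiff_quadraticTest ..), lapRd_quadraticTest]
    simp
  have hev : ∀ᶠ y in 𝓝 z, y ∈ U ∧ lapRd θ' y < 0 ∧ v y - θ y ≤ v z - θ z := by
    refine (hU.eventually_mem hz).and (Eventually.and ?_ hmax)
    exact hθ'c.continuous_lapRd.continuousAt.eventually_lt continuousAt_const
      (by rw [hlap]; exact hεd)
  obtain ⟨R, hR, hball⟩ := Metric.nhds_basis_closedBall.eventually_iff.1 hev
  set ρ := R / 2 with hρ
  have hρ0 : 0 < ρ := by linarith
  obtain ⟨g, hg, hgv⟩ := h.exists_contDiff_approx hv (z := z) (ρ := ρ) (R := R) (by linarith)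
    (fun y hy => (hball hy).1) (η := ε * ρ ^ 2 / 4) (by positivity)
  obtain ⟨y, hy, hymax⟩ := (isCompact_closedBall z ρ).exists_isMaxOn
    ⟨z, mem_closedBall_self hρ0.le⟩ (hg.continuous.sub hθ'c.continuous).continuousOn
  have hyz := hymax (mem_closedBall_self hρ0.le)
  have hsub : closedBall z ρ ⊆ closedBall z R := closedBall_subset_closedBall (by linarith)
  have hq : quadraticTest z 0 0 0 ε y = ε * ‖y - z‖ ^ 2 := by simp [quadraticTest]
  have hqz : quadraticTest z 0 0 0 ε z = 0 := by simp [quadraticTest]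
  have hylt : y ∈ ball z ρ := by
    rw [mem_ball, dist_eq_norm]
    refine lt_of_le_of_ne (by simpa [dist_eq_norm] using hy) fun heq => ?_
    have h1 := abs_le.1 (hgv y hy).1
    have h2 := abs_le.1 (hgv z (mem_closedBall_self hρ0.le)).1
    have h3 := (hball (hsub hy)).2.2
    have h4 : g z - (θ z + quadraticTest z 0 0 0 ε z) ≤ g y - (θ y + quadraticTest z 0 0 0 ε y) :=
      hyz
    rw [hq, hqz, heq] at h4
    have : 0 < ε * ρ ^ 2 := by positivity
    linarith
  have hloc : IsLocalMax (fun y => g y + -θ' y) y := by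
    filter_upwards [isOpen_ball.mem_nhds hylt] with x hx
    simpa [sub_eq_add_neg] using hymax (ball_subset_closedBall hx)
  have := hloc.lapRd_nonpos (hg.add hθ'c.neg)
  rw [lapRd_add hg hθ'c.neg, lapRd_neg] at this
  linarith [(hgv y hy).2, (hball (hsub hy)).2.1]

end Viscosity

/-! ### A boundary point principle -/

section Hopf

variable {d : ℕ}

/-- A non-negative function cannot vanish at a point `q` while being positive on a ball whose
boundary passes through `q` and superharmonic (in the viscosity sense) on that ball and at `q`. -/
lemma not_superharmonic_of_zero_on_sphere {w : Rd d → ℝ} (hw : Continuous w) (hw0 : ∀ y, 0 ≤ w y)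
    {q e : Rd d} (he : ‖e‖ = 1) (hq : w q = 0) {κ R : ℝ} (hκ : 0 < κ) (hR : 0 < R)
    (hpos : ∀ y ∈ closedBall q R, y ≠ q → ‖y - q‖ ^ 2 ≤ κ * inner ℝ (y - q) e → 0 < w y) :
    ∃ y ∈ closedBall q R, ‖y - q‖ ^ 2 ≤ κ * inner ℝ (y - q) e ∧
      ∃ θ : Rd d → ℝ, ContDiff ℝ 2 θ ∧ IsLocalMin (fun x => w x - θ x) y ∧ 0 < lapRd θ y := by
  set B := 2 / κ with hB
  have hB0 : 0 < B := by positivity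
  have hBκ : B * κ = 2 := div_mul_cancel₀ _ hκ.ne'
  set A := B * d + 1 with hA
  have hA0 : 0 < A := by positivity
  set ρ := min R (1 / A) with hρ
  have hρ0 : 0 < ρ := lt_min hR (by positivity)
  have hρA : A * ρ ≤ 1 := by
    calc A * ρ ≤ A * (1 / A) := by gcongr; exact min_le_right _ _
      _ = 1 := by field_simp
  set P : Rd d → ℝ := fun y => inner ℝ (y - q) e + A * inner ℝ (y - q) e ^ 2 - B * ‖y - q‖ ^ 2
    with hP
  have hPq : ∀ η y, quadraticTest q e η (η * A) (-(η * B)) y = η * P y := fun η y => by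
    simp only [quadraticTest, hP]; ring
  have hPc : Continuous P := by fun_prop
  have hs : ∀ y ∈ closedBall q ρ, |inner ℝ (y - q) e| ≤ ρ := fun y hy => by
    have h1 := abs_real_inner_le_norm (y - q) e
    rw [he, mul_one, ← dist_eq_norm] at h1
    exact h1.trans hy
  have hPpos : ∀ y ∈ closedBall q ρ, 0 ≤ P y →
      ‖y - q‖ ^ 2 ≤ κ * inner ℝ (y - q) e ∧ P y ≤ 2 * ρ := by
    intro y hy hPy
    have h1 := hs y hy
    simp only [hP] at hPy ⊢
    set s : ℝ := inner ℝ (y - q) e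
    set n := ‖y - q‖ ^ 2
    have hn : 0 ≤ n := by positivity
    have hAs : |A * s| ≤ 1 := by
      rw [abs_mul, abs_of_pos hA0]
      exact (mul_le_mul_of_nonneg_left h1 hA0.le).trans hρA
    have h2 := abs_le.1 hAs
    have h3 := abs_le.1 h1
    have hs0 : 0 ≤ s := by
      by_contra! hneg
      have h4 : s * (1 + A * s) ≤ 0 := mul_nonpos_of_nonpos_of_nonneg hneg.le (by linarith)
      have h5 : n = 0 := by nlinarith
      have h6 : y - q = 0 := by simpa [n] using h5
      have : s = 0 := by simp [s, h6]
      linarith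
    have h4 : A * s ^ 2 ≤ s := by nlinarith
    have h5 : B * n ≤ 2 * s := by linarith
    constructor
    · have h6 : n = κ * (B * n) / 2 := by linear_combination (-n / 2) * hBκ
      rw [h6]
      nlinarith
    · have : 0 ≤ B * n := by positivity
      linarith
  have hsub : closedBall q ρ ⊆ closedBall q R := closedBall_subset_closedBall (min_le_left _ _)
  obtain ⟨m, hm0, hm⟩ : ∃ m, 0 < m ∧ ∀ y ∈ sphere q ρ ∩ {y | 0 ≤ P y}, m ≤ w y := by
    refine ((isCompact_sphere q ρ).inter_right
      (isClosed_le continuous_const hPc)).exists_forall_le' hw.continuousOn fun y hy => ?_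
    refine hpos y (hsub (sphere_subset_closedBall hy.1)) ?_
      (hPpos y (sphere_subset_closedBall hy.1) hy.2).1
    rintro rfl
    simpa [hρ0.ne] using hy.1
  set η := m / (4 * ρ) with hη
  have hη0 : 0 < η := by positivity
  have hηρ : η * (2 * ρ) = m / 2 := by rw [hη]; field_simp; ring
  obtain ⟨y, hy, hymin⟩ := (isCompact_closedBall q ρ).exists_isMinOn
    ⟨q, mem_closedBall_self hρ0.le⟩ (hw.sub (continuous_const.mul hPc)
      : Continuous fun y => w y - η * P y).continuousOn
  have hyq : w y - η * P y ≤ 0 := by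
    have : w y - η * P y ≤ w q - η * P q := hymin (mem_closedBall_self hρ0.le)
    simpa [hq, hP] using this
  have hPy : 0 ≤ P y := by
    by_contra! hneg
    have := mul_neg_of_pos_of_neg hη0 hneg
    linarith [hw0 y]
  have hyball : y ∈ ball q ρ := by
    refine mem_ball.2 (lt_of_le_of_ne (mem_closedBall.1 hy) fun heq => ?_)
    have h1 := hm y ⟨heq, hPy⟩
    have h2 := mul_le_mul_of_nonneg_left (hPpos y hy hPy).2 hη0.le
    linarith
  refine ⟨y, hsub hy, (hPpos y hy hPy).1, quadraticTest q e η (η * A) (-(η * B)),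
    contDiff_quadraticTest .., ?_, ?_⟩
  · filter_upwards [isOpen_ball.mem_nhds hyball] with x hx
    simp only [hPq]
    exact hymin (ball_subset_closedBall hx)
  · rw [lapRd_quadraticTest, he, hA]
    linarith

end Hopf

/-! ### Periodic functions -/

section Periodic

variable {d : ℕ}

lemma exists_isCompact_forall_period (d : ℕ) : ∃ K : Set (Rd d), IsCompact K ∧
    ∀ x : Rd d, ∃ v : Rd d, x + v ∈ K ∧
      ∀ f : Rd d → ℝ, PeriodicRd f → ∀ z, f (z + v) = f z := by
  refine ⟨WithLp.toLp 2 '' Set.pi univ fun _ => Icc 0 (2 * π),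
    (isCompact_univ_pi fun _ => isCompact_Icc).image (PiLp.continuous_toLp 2 _), fun x => ?_⟩
  refine ⟨∑ j, (-⌊x j / (2 * π)⌋) • ((2 * π) • EuclideanSpace.single j (1 : ℝ)), ?_, ?_⟩
  · refine ⟨_, ?_, WithLp.toLp_ofLp _ _⟩
    intro j _
    have hpi : 0 < 2 * π := by positivity
    have h1 := Int.floor_le (x j / (2 * π))
    have h2 := (Int.lt_floor_add_one (x j / (2 * π))).le
    rw [le_div_iff₀ hpi] at h1
    rw [div_le_iff₀ hpi] at h2
    have h3 : (x + ∑ j, (-⌊x j / (2 * π)⌋) • ((2 * π) • EuclideanSpace.single j (1 : ℝ))) j =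
        x j - ⌊x j / (2 * π)⌋ * (2 * π) := by
      simp [WithLp.ofLp_sum, Finset.sum_apply, Pi.single_apply, sub_eq_add_neg,
        mul_comm]
    change _ ∈ Icc _ _
    rw [h3]
    constructor <;> linarith
  · intro f hf
    have h : ∀ s : Finset (Fin d), Function.Periodic f
        (∑ j ∈ s, (-⌊x j / (2 * π)⌋) • ((2 * π) • EuclideanSpace.single j (1 : ℝ))) := by
      intro s
      induction s using Finset.induction_on with
      | empty => simp [Function.Periodic]
      | insert j s hj ih =>
        rw [Finset.sum_insert hj]
        exact (Function.Periodic.zsmul (fun z => hf z j) _).add_period ih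
    exact h Finset.univ

lemma PeriodicRd.exists_forall_le {f : Rd d → ℝ} (hf : PeriodicRd f) (hc : Continuous f) :
    ∃ x, ∀ y, f y ≤ f x := by
  obtain ⟨K, hK, hper⟩ := exists_isCompact_forall_period d
  obtain ⟨v, hv, -⟩ := hper 0
  obtain ⟨x, -, hx⟩ := hK.exists_isMaxOn ⟨_, hv⟩ hc.continuousOn
  refine ⟨x, fun y => ?_⟩
  obtain ⟨v, hv, hfv⟩ := hper y
  rw [← hfv f hf y]
  exact hx hv

lemma PeriodicRd.neg {f : Rd d → ℝ} (hf : PeriodicRd f) : PeriodicRd fun x => -f x :=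
  fun x j => congrArg Neg.neg (hf x j)

lemma PeriodicRd.lapRd {f : Rd d → ℝ} (hf : PeriodicRd f) : PeriodicRd (lapRd f) :=
  fun x j => lapRd_periodic_shift (fun z => hf z j) x

lemma PeriodicRd.exists_lapRd_eq_zero {f : Rd d → ℝ} (hf : PeriodicRd f) (hc : ContDiff ℝ 2 f) :
    ∃ x, _root_.lapRd f x = 0 := by
  obtain ⟨x, hx⟩ := hf.exists_forall_le hc.continuous
  obtain ⟨y, hy⟩ := hf.neg.exists_forall_le hc.continuous.neg
  refine mem_range_of_exists_le_of_exists_ge hc.continuous_lapRd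
    ⟨x, IsLocalMax.lapRd_nonpos hc (Eventually.of_forall hx)⟩ ⟨y, ?_⟩
  have := IsLocalMax.lapRd_nonpos hc.neg (Eventually.of_forall hy)
  rw [lapRd_neg] at this
  linarith

/-- A periodic continuous function that is weakly subharmonic on the whole space is constant. -/
lemma PeriodicRd.eq_of_weakSubharmonicOn_univ {v : Rd d → ℝ} (hper : PeriodicRd v)
    (hv : Continuous v) (h : WeakSubharmonicOn v univ) : ∃ c, ∀ x, v x = c := by
  obtain ⟨x₀, hx₀⟩ := hper.exists_forall_le hv
  refine ⟨v x₀, ?_⟩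
  by_contra! hne
  obtain ⟨p, hp⟩ := hne
  obtain ⟨q, hq, hpq⟩ := (isClosed_eq hv continuous_const :
    IsClosed {x | v x = v x₀}).exists_infDist_eq_dist ⟨x₀, rfl⟩ p
  have hR : 0 < dist p q := dist_pos.2 fun h => hp (h ▸ hq)
  have hR' : 0 < ‖p - q‖ := by rwa [← dist_eq_norm]
  have he : ‖(‖p - q‖⁻¹ • (p - q))‖ = 1 := by
    rw [norm_smul, norm_inv, norm_norm, inv_mul_cancel₀ hR'.ne']
  obtain ⟨y, -, -, θ, hθ, hmin, hlap⟩ := not_superharmonic_of_zero_on_sphere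
    (w := fun y => v x₀ - v y) (continuous_const.sub hv) (fun y => sub_nonneg.2 (hx₀ y)) he
    (sub_eq_zero.2 (Eq.symm hq)) hR' hR' fun y _ hyq hy => by
      refine sub_pos.2 (lt_of_le_of_ne (hx₀ y) fun hyS => ?_)
      have h1 : dist p q ≤ dist p y := hpq ▸ infDist_le_dist_of_mem hyS
      rw [inner_smul_right, ← mul_assoc, mul_inv_cancel₀ hR'.ne', one_mul] at hy
      have h2 : 0 < ‖y - q‖ := norm_pos_iff.2 (sub_ne_zero.2 hyq)
      have h3 : dist p y ^ 2 = ‖y - q‖ ^ 2 - 2 * inner ℝ (y - q) (p - q) + ‖p - q‖ ^ 2 := by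
        rw [← norm_sub_sq_real, dist_comm, dist_eq_norm]
        congr 2
        abel
      rw [dist_eq_norm p q] at h1
      nlinarith
  have hmax : IsLocalMax (fun x => v x - -θ x) y := by
    filter_upwards [hmin] with x hx
    linarith
  have := h.lapRd_nonneg_of_isLocalMax hv isOpen_univ (mem_univ y) hθ.neg hmax
  rw [lapRd_neg] at this
  linarith

end Periodic

/-! ### Contact with the lower obstacle -/

section LowerObstacle

variable {d : ℕ}

/-- A `C²` function stays quadratically close to its first-order expansion. -/
lemma ContDiff.exists_quadratic_remainder {g : Rd d → ℝ} (hg : ContDiff ℝ 2 g) (q : Rd d) :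
    ∃ C r : ℝ, 0 ≤ C ∧ 0 < r ∧ ∀ y ∈ closedBall q r,
      |g y - g q - fderiv ℝ g q (y - q)| ≤ C * ‖y - q‖ ^ 2 := by
  obtain ⟨C, t, ht, hL⟩ :=
    (hg.fderiv_right (m := 1) (by norm_num)).contDiffAt (x := q) |>.exists_lipschitzOnWith
  obtain ⟨r, hr, hrt⟩ := Metric.nhds_basis_closedBall.mem_iff.1 ht
  refine ⟨C, r, C.2, hr, fun y hy => ?_⟩
  have hsub : closedBall q ‖y - q‖ ⊆ t := by
    refine (closedBall_subset_closedBall ?_).trans hrt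
    rwa [← dist_eq_norm]
  have := (convex_closedBall q ‖y - q‖).norm_image_sub_le_of_norm_fderiv_le' (𝕜 := ℝ)
    (f := g) (φ := fderiv ℝ g q) (C := C * ‖y - q‖) (x := q) (y := y)
    (fun x _ => hg.differentiable (by norm_num) x) (fun x hx => ?_)
    (mem_closedBall_self (norm_nonneg _)) (by simp [dist_eq_norm])
  · rw [Real.norm_eq_abs] at this
    linarith
  · rw [← dist_eq_norm]
    refine (hL.dist_le_mul x (hsub hx) q (hsub (mem_closedBall_self (norm_nonneg _)))).trans ?_
    gcongr
    exact hx

variable {φm φp u : Rd d → ℝ}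

lemma IsDOPSolution.weakSubharmonicOn (hu : IsDOPSolution φm φp u) :
    WeakSubharmonicOn u {x | φm x < u x} :=
  hu.2.2.2.1

lemma IsDOPSolution.neg (hu : IsDOPSolution φm φp u) :
    IsDOPSolution (fun x => -φp x) (fun x => -φm x) (fun x => -u x) := by
  obtain ⟨hc, hper, hb, h1, h2⟩ := hu
  refine ⟨hc.neg, hper.neg, fun x => ⟨neg_le_neg (hb x).2, neg_le_neg (hb x).1⟩, ?_, ?_⟩
  · intro χ hχ hχc hχ0 hs
    have := h2 χ hχ hχc hχ0 (by simpa using hs)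
    simpa [neg_mul, integral_neg] using this
  · intro χ hχ hχc hχ0 hs
    have := h1 χ hχ hχc hχ0 (by simpa using hs)
    simpa [neg_mul, integral_neg] using this

/-- Above the lower obstacle, `Δ(u - φ₋) ≥ -Δφ₋` in the viscosity sense. -/
lemma IsDOPSolution.le_lapRd_of_isLocalMax (hu : IsDOPSolution φm φp u) (hφ : ContDiff ℝ 2 φm)
    {y : Rd d} (hy : φm y < u y) {θ : Rd d → ℝ} (hθ : ContDiff ℝ 2 θ)
    (hmax : IsLocalMax (fun x => u x - φm x - θ x) y) : -lapRd φm y ≤ lapRd θ y := by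
  have := hu.weakSubharmonicOn.lapRd_nonneg_of_isLocalMax hu.1
    (isOpen_lt hφ.continuous hu.1) hy (hφ.add hθ) (by simpa only [sub_sub] using hmax)
  rw [lapRd_add hφ hθ] at this
  linarith

/-- Below the upper obstacle, `Δ(u - φ₋) ≤ -Δφ₋` in the viscosity sense. -/
lemma IsDOPSolution.lapRd_le_of_isLocalMin (hu : IsDOPSolution φm φp u) (hφ : ContDiff ℝ 2 φm)
    (hφp : Continuous φp) {y : Rd d} (hy : u y < φp y) {θ : Rd d → ℝ} (hθ : ContDiff ℝ 2 θ)
    (hmin : IsLocalMin (fun x => u x - φm x - θ x) y) : lapRd θ y ≤ -lapRd φm y := by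
  have := hu.neg.weakSubharmonicOn.lapRd_nonneg_of_isLocalMax hu.1.neg
    (isOpen_lt hφp.neg hu.1.neg) (neg_lt_neg hy) (hφ.add hθ).neg (by
      filter_upwards [hmin] with x hx
      simp only [Pi.neg_apply]
      linarith)
  rw [lapRd_neg, lapRd_add hφ hθ] at this
  linarith

lemma IsDOPSolution.lapRd_nonpos_of_contact (hu : IsDOPSolution φm φp u) (hφ : ContDiff ℝ 2 φm)
    (hφp : Continuous φp) (hlt : ∀ x, φm x < φp x) {x : Rd d} (hx : u x = φm x) :
    lapRd φm x ≤ 0 := by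
  have := hu.lapRd_le_of_isLocalMin hφ hφp (hx ▸ hlt x) (contDiff_quadraticTest 0 0 0 0 0)
    (Eventually.of_forall fun y => by
      have := (hu.2.2.1 y).1
      simp [quadraticTest, hx, this])
  rw [lapRd_quadraticTest] at this
  simp at this
  linarith

/-- The lower obstacle is strictly superharmonic at the contact points. -/
lemma IsDOPSolution.lapRd_neg_of_contact (hu : IsDOPSolution φm φp u) (hφ : ContDiff ℝ 4 φm)
    (hφp : Continuous φp) (hlt : ∀ x, φm x < φp x)
    (hnd : ∀ x : Rd d, lapRd φm x = 0 → fderiv ℝ (lapRd φm) x ≠ 0) {q : Rd d}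
    (hq : u q = φm q) : lapRd φm q < 0 := by
  have hφ2 : ContDiff ℝ 2 φm := hφ.of_le (by norm_num)
  have hG : ContDiff ℝ 2 (lapRd φm) := ContDiff.lapRd (by norm_num; exact hφ)
  refine lt_of_le_of_ne (hu.lapRd_nonpos_of_contact hφ2 hφp hlt hq) fun hzero => ?_
  obtain ⟨C, r, hC, hr, hquad⟩ := hG.exists_quadratic_remainder q
  set γ := (InnerProductSpace.toDual ℝ (Rd d)).symm (fderiv ℝ (lapRd φm) q) with hγ
  have hγi : ∀ v, fderiv ℝ (lapRd φm) q v = inner ℝ v γ := fun v => by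
    rw [real_inner_comm, hγ, InnerProductSpace.toDual_symm_apply]
  have hγ0 : 0 < ‖γ‖ := by
    rw [hγ, LinearIsometryEquiv.norm_map]
    exact norm_pos_iff.2 (hnd q hzero)
  obtain ⟨r', hr', hsub⟩ := Metric.nhds_basis_closedBall.mem_iff.1
    ((isOpen_lt hu.1 hφp).mem_nhds (show u q < φp q from hq ▸ hlt q))
  set κ := ‖γ‖ / (2 * (C + 1)) with hκ
  have hκ0 : 0 < κ := by positivity
  have hCκ : C * κ < ‖γ‖ := by
    have : κ * (2 * (C + 1)) = ‖γ‖ := div_mul_cancel₀ _ (by positivity)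
    nlinarith
  have hlap : ∀ y ∈ closedBall q (min r r'), y ≠ q →
      ‖y - q‖ ^ 2 ≤ κ * inner ℝ (y - q) (‖γ‖⁻¹ • γ) → 0 < lapRd φm y := by
    intro y hy hyq hys
    have h1 := (abs_le.1 (hquad y (closedBall_subset_closedBall (min_le_left _ _) hy))).1
    have h2 : inner ℝ (y - q) γ = ‖γ‖ * inner ℝ (y - q) (‖γ‖⁻¹ • γ) := by
      rw [inner_smul_right, ← mul_assoc, mul_inv_cancel₀ hγ0.ne', one_mul]
    rw [hzero, hγi, h2] at h1
    set s : ℝ := inner ℝ (y - q) (‖γ‖⁻¹ • γ)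
    have h3 : 0 < ‖y - q‖ ^ 2 := pow_pos (norm_pos_iff.2 (sub_ne_zero.2 hyq)) 2
    have hs : 0 < s := pos_of_mul_pos_right (h3.trans_le hys) hκ0.le
    have h4 : C * ‖y - q‖ ^ 2 ≤ C * (κ * s) := mul_le_mul_of_nonneg_left hys hC
    have h5 : C * κ * s < ‖γ‖ * s := mul_lt_mul_of_pos_right hCκ hs
    linarith
  obtain ⟨y, hy, hys, θ, hθ, hmin, hθlap⟩ := not_superharmonic_of_zero_on_sphere
    (w := fun y => u y - φm y) (hu.1.sub hφ.continuous) (fun y => sub_nonneg.2 (hu.2.2.1 y).1)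
    (e := ‖γ‖⁻¹ • γ) (by rw [norm_smul, norm_inv, norm_norm, inv_mul_cancel₀ hγ0.ne'])
    (sub_eq_zero.2 hq) hκ0 (lt_min hr hr') fun y hy hyq hys => by
      refine lt_of_le_of_ne (sub_nonneg.2 (hu.2.2.1 y).1) fun h0 => ?_
      have h1 := hu.lapRd_nonpos_of_contact hφ2 hφp hlt (sub_eq_zero.1 h0.symm)
      linarith [hlap y hy hyq hys]
  have h1 := hu.lapRd_le_of_isLocalMin hφ2 hφp
    (hsub (closedBall_subset_closedBall (min_le_right _ _) hy)) hθ hmin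
  by_cases hyq : y = q
  · rw [hyq, hzero] at h1
    rw [hyq] at hθlap
    linarith
  · linarith [hlap y hy hyq hys]

lemma IsDOPSolution.exists_contact (hu : IsDOPSolution φm φp u)
    (hmaxmin : sInf (range φp) < sSup (range φm)) : ∃ x, u x = φm x := by
  by_contra! hne
  have huniv : {x | φm x < u x} = univ :=
    eq_univ_of_forall fun x => lt_of_le_of_ne (hu.2.2.1 x).1 (hne x).symm
  obtain ⟨c, hc⟩ := hu.2.1.eq_of_weakSubharmonicOn_univ hu.1 (huniv ▸ hu.weakSubharmonicOn)
  refine hmaxmin.not_ge (le_trans (b := c) ?_ ?_)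
  · refine csSup_le (range_nonempty _) ?_
    rintro _ ⟨x, rfl⟩
    exact hc x ▸ (hu.2.2.1 x).1
  · refine le_csInf (range_nonempty _) ?_
    rintro _ ⟨x, rfl⟩
    exact hc x ▸ (hu.2.2.1 x).2

/-- Quadratic growth away from a boundary point of the contact set, where `-Δφ₋ ≥ L`. -/
lemma IsDOPSolution.growth (hu : IsDOPSolution φm φp u) (hφ : ContDiff ℝ 2 φm)
    (hd : 0 < d) {L r : ℝ} (hL : 0 < L) (hr : 0 < r) {x : Rd d}
    (hx : x ∈ frontier {y | u y = φm y}) (hlap : ∀ y ∈ ball x r, L ≤ -lapRd φm y) :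
    r ^ 2 * L / (3 * (d : ℝ)) ≤ sSup ((fun y => u y - φm y) '' ball x r) := by
  have hd' : (0 : ℝ) < d := by exact_mod_cast hd
  have hbdd : BddAbove ((fun y => u y - φm y) '' ball x r) :=
    ((isCompact_closedBall x r).bddAbove_image (hu.1.sub hφ.continuous).continuousOn).mono
      (image_mono ball_subset_closedBall)
  rw [frontier_eq_closure_inter_closure] at hx
  obtain ⟨y, hyM, hxy⟩ := Metric.mem_closure_iff.1 hx.2 (r / 10) (by linarith)
  have hwy : φm y < u y := lt_of_le_of_ne (hu.2.2.1 y).1 fun h => hyM h.symm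
  set c := 9 * L / (20 * d) with hc
  have hcd : c * d = 9 * L / 20 := by rw [hc]; field_simp
  have hc0 : 0 < c := by positivity
  have hρ0 : 0 < 9 * r / 10 := by linarith
  have hsub : closedBall y (9 * r / 10) ⊆ ball x r := fun z hz => by
    rw [mem_ball]
    rw [mem_closedBall] at hz
    rw [dist_comm] at hxy
    linarith [dist_triangle z y x]
  have hθ : ∀ z, quadraticTest y 0 0 0 c z = c * ‖z - y‖ ^ 2 := fun z => by simp [quadraticTest]
  have hθc : ContDiff ℝ 2 (quadraticTest y 0 0 0 c) := contDiff_quadraticTest ..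
  obtain ⟨z, hz, hzmax⟩ := (isCompact_closedBall y (9 * r / 10)).exists_isMaxOn
    ⟨y, mem_closedBall_self hρ0.le⟩ ((hu.1.sub hφ.continuous).sub hθc.continuous :
      Continuous fun z => u z - φm z - quadraticTest y 0 0 0 c z).continuousOn
  have hzy : u y - φm y ≤ u z - φm z - c * ‖z - y‖ ^ 2 := by
    have : u y - φm y - quadraticTest y 0 0 0 c y ≤ u z - φm z - quadraticTest y 0 0 0 c z :=
      hzmax (mem_closedBall_self hρ0.le)
    simpa [hθ] using this
  have hznn : 0 ≤ c * ‖z - y‖ ^ 2 := by positivity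
  have hzsphere : ‖z - y‖ = 9 * r / 10 := by
    by_contra hne
    have hzball : z ∈ ball y (9 * r / 10) := by
      rw [mem_closedBall, dist_eq_norm] at hz
      rw [mem_ball, dist_eq_norm]
      exact lt_of_le_of_ne hz hne
    have h1 := hu.le_lapRd_of_isLocalMax hφ (y := z) (by linarith) hθc (by
      filter_upwards [isOpen_ball.mem_nhds hzball] with t ht
      exact hzmax (ball_subset_closedBall ht))
    rw [lapRd_quadraticTest] at h1
    have h2 := hlap z (hsub hz)
    simp only [mul_zero, zero_mul, zero_add] at h1
    linarith
  refine le_trans ?_ (le_csSup hbdd (mem_image_of_mem _ (hsub hz)))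
  rw [hzsphere] at hzy
  have h3 : r ^ 2 * L / (3 * (d : ℝ)) ≤ c * (9 * r / 10) ^ 2 := by
    rw [hc, div_le_iff₀ (by positivity)]
    have : 9 * L / (20 * d) * (9 * r / 10) ^ 2 * (3 * (d : ℝ)) = (2187 / 2000) * (r ^ 2 * L) := by
      field_simp
      ring
    rw [this]
    have : 0 < r ^ 2 * L := by positivity
    linarith
  exact h3.trans (by linarith)

/-- Non-degenerate growth near the contact set with the lower obstacle. -/
theorem IsDOPSolution.lower_growth (hu : IsDOPSolution φm φp u) (hφ : ContDiff ℝ 4 φm)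
    (hφp : Continuous φp) (hper : PeriodicRd φm) (hd : 0 < d) (hlt : ∀ x, φm x < φp x)
    (hmaxmin : sInf (range φp) < sSup (range φm))
    (hnd : ∀ x : Rd d, lapRd φm x = 0 → fderiv ℝ (lapRd φm) x ≠ 0) {D L : ℝ}
    (hD : D = sInf {r : ℝ | ∃ a ∈ {x : Rd d | lapRd φm x = 0}, ∃ b ∈ {x : Rd d | u x = φm x},
      r = dist a b})
    (hL : L = sInf ((fun x => -lapRd φm x) ''
      {x : Rd d | infDist x {y : Rd d | u y = φm y} ≤ D / 2})) :
    0 < D ∧ 0 < L ∧ ∀ r : ℝ, 0 < r → r ≤ D / 2 → ∀ x ∈ frontier {y : Rd d | u y = φm y},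
      r ^ 2 * L / (3 * (d : ℝ)) ≤ sSup ((fun y => u y - φm y) '' ball x r) := by
  have hφ2 : ContDiff ℝ 2 φm := hφ.of_le (by norm_num)
  have hGc : Continuous (lapRd φm) := hφ2.continuous_lapRd
  set M : Set (Rd d) := {y | u y = φm y} with hM
  set Γ : Set (Rd d) := {x | lapRd φm x = 0} with hΓ
  have hMcl : IsClosed M := isClosed_eq hu.1 hφ.continuous
  have hΓcl : IsClosed Γ := isClosed_eq hGc continuous_const
  have hMne : M.Nonempty := hu.exists_contact hmaxmin
  have hΓne : Γ.Nonempty := hper.exists_lapRd_eq_zero hφ2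
  have hMneg : ∀ x ∈ M, lapRd φm x < 0 := fun x hx => hu.lapRd_neg_of_contact hφ hφp hlt hnd hx
  obtain ⟨K, hK, hKper⟩ := exists_isCompact_forall_period d
  have hDle : ∀ a ∈ Γ, ∀ b ∈ M, D ≤ dist a b := fun a ha b hb => by
    rw [hD]
    refine csInf_le ⟨0, ?_⟩ ⟨a, ha, b, hb, rfl⟩
    rintro _ ⟨a, -, b, -, rfl⟩
    exact dist_nonneg
  have hD0 : 0 < D := by
    obtain ⟨δ, hδ, hδle⟩ : ∃ δ, 0 < δ ∧ ∀ b ∈ M ∩ K, δ ≤ infDist b Γ :=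
      (hK.inter_left hMcl).exists_forall_le' (continuous_infDist_pt Γ).continuousOn fun b hb =>
        (hΓcl.notMem_iff_infDist_pos hΓne).1 fun h => (hMneg b hb.1).ne h
    refine hδ.trans_le ?_
    rw [hD]
    obtain ⟨a₀, ha₀⟩ := hΓne
    obtain ⟨b₀, hb₀⟩ := hMne
    refine le_csInf ⟨_, a₀, ha₀, b₀, hb₀, rfl⟩ ?_
    rintro _ ⟨a, ha, b, hb, rfl⟩
    obtain ⟨v, hvK, hv⟩ := hKper b
    have hb' : b + v ∈ M := by
      change u (b + v) = φm (b + v)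
      rw [hv u hu.2.1, hv φm hper]
      exact hb
    have ha' : a + v ∈ Γ := (hv _ hper.lapRd a).trans ha
    calc δ ≤ infDist (b + v) Γ := hδle _ ⟨hb', hvK⟩
      _ ≤ dist (b + v) (a + v) := infDist_le_dist_of_mem ha'
      _ = dist a b := by rw [dist_add_right, dist_comm]
  set N : Set (Rd d) := {x | infDist x M ≤ D / 2} with hN
  have hNcl : IsClosed N := isClosed_le (continuous_infDist_pt M) continuous_const
  have hNpos : ∀ x ∈ N, 0 < -lapRd φm x := by
    intro x hx
    by_contra! hneg
    obtain ⟨b, hb, hxb⟩ := hMcl.exists_infDist_eq_dist hMne x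
    have hxb' : dist x b ≤ D / 2 := hxb ▸ hx
    obtain ⟨a, ha, ha0⟩ : ∃ a ∈ closedBall b (D / 2), lapRd φm a = 0 := by
      refine (convex_closedBall b (D / 2)).isPreconnected.intermediate_value
        (mem_closedBall_self (by linarith)) (mem_closedBall.2 hxb') hGc.continuousOn
        ⟨(hMneg b hb).le, by linarith⟩
    linarith [hDle a ha0 b hb, mem_closedBall.1 ha]
  have hLle : ∀ x ∈ N, L ≤ -lapRd φm x := fun x hx => by
    rw [hL]
    refine csInf_le ⟨0, ?_⟩ ⟨x, hx, rfl⟩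
    rintro _ ⟨x, hx, rfl⟩
    exact (hNpos x hx).le
  have hL0 : 0 < L := by
    obtain ⟨δ, hδ, hδle⟩ : ∃ δ, 0 < δ ∧ ∀ x ∈ N ∩ K, δ ≤ -lapRd φm x :=
      (hK.inter_left hNcl).exists_forall_le' hGc.neg.continuousOn fun x hx => hNpos x hx.1
    refine hδ.trans_le ?_
    rw [hL]
    obtain ⟨b₀, hb₀⟩ := hMne
    have hb₀N : b₀ ∈ N := by
      change infDist b₀ M ≤ D / 2
      rw [infDist_zero_of_mem hb₀]
      linarith
    refine le_csInf ⟨_, b₀, hb₀N, rfl⟩ ?_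
    rintro _ ⟨x, hx, rfl⟩
    obtain ⟨v, hvK, hv⟩ := hKper x
    have hx' : x + v ∈ N := by
      obtain ⟨b, hb, hxb⟩ := hMcl.exists_infDist_eq_dist ⟨b₀, hb₀⟩ x
      have hb' : b + v ∈ M := by
        change u (b + v) = φm (b + v)
        rw [hv u hu.2.1, hv φm hper]
        exact hb
      calc infDist (x + v) M ≤ dist (x + v) (b + v) := infDist_le_dist_of_mem hb'
        _ = infDist x M := by rw [dist_add_right, hxb]
        _ ≤ D / 2 := hx
    have := hδle _ ⟨hx', hvK⟩
    rwa [hv _ hper.lapRd] at this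
  refine ⟨hD0, hL0, fun r hr hrD x hx => hu.growth hφ2 hd hL0 hr hx fun y hy => hLle y ?_⟩
  exact (infDist_le_dist_of_mem (hMcl.frontier_subset hx)).trans
    ((mem_ball.1 hy).le.trans hrD)

end LowerObstacle

/-- **Proposition (non-degenerate maximal growth near the free boundary).** -/
theorem dop_maximal_growth {d : ℕ}
    (φm φp : Rd d → ℝ) (τ : ℝ) (hτ : 0 < τ)
    (hmreg : ContDiff ℝ 4 φm) (hpreg : ContDiff ℝ 4 φp)
    (hmper : PeriodicRd φm) (hpper : PeriodicRd φp)
    (hmnc : ∃ x y : Rd d, φm x ≠ φm y) (hpnc : ∃ x y : Rd d, φp x ≠ φp y)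
    (hsep : ∀ x : Rd d, τ ≤ φp x - φm x)
    (hmaxmin : sInf (Set.range φp) < sSup (Set.range φm))
    (hndm : ∀ x : Rd d, lapRd φm x = 0 → fderiv ℝ (lapRd φm) x ≠ 0)
    (hndp : ∀ x : Rd d, lapRd φp x = 0 → fderiv ℝ (lapRd φp) x ≠ 0) :
    ∀ u : Rd d → ℝ, IsDOPSolution φm φp u →
      -- with the contact sets M± and the distances d± = dist(Γ±, M±):
      ∀ dm dp Lm Lp : ℝ,
      dm = sInf {r : ℝ | ∃ a ∈ {x : Rd d | lapRd φm x = 0}, ∃ b ∈ {x : Rd d | u x = φm x},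
        r = dist a b} →
      dp = sInf {r : ℝ | ∃ a ∈ {x : Rd d | lapRd φp x = 0}, ∃ b ∈ {x : Rd d | u x = φp x},
        r = dist a b} →
      Lm = sInf ((fun x => -lapRd φm x) ''
        {x : Rd d | Metric.infDist x {y : Rd d | u y = φm y} ≤ dm / 2}) →
      Lp = sInf ((fun x => lapRd φp x) ''
        {x : Rd d | Metric.infDist x {y : Rd d | u y = φp y} ≤ dp / 2}) →
      0 < dm ∧ 0 < dp ∧ 0 < Lm ∧ 0 < Lp ∧
      ∃ C₀ > 0, ∀ r : ℝ, 0 < r → r ≤ 1 / C₀ →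
        (∀ x ∈ frontier {y : Rd d | u y = φm y},
          r ^ 2 * Lm / (3 * (d : ℝ)) ≤
            sSup ((fun y => u y - φm y) '' Metric.ball x r)) ∧
        (∀ x ∈ frontier {y : Rd d | u y = φp y},
          r ^ 2 * Lp / (3 * (d : ℝ)) ≤
            sSup ((fun y => φp y - u y) '' Metric.ball x r)) := by
  intro u hu dm dp Lm Lp hdm hdp hLm hLp
  have hd : 0 < d := by
    refine Nat.pos_of_ne_zero fun h0 => ?_
    subst h0
    obtain ⟨x, y, hxy⟩ := hmnc
    exact hxy (congrArg φm (Subsingleton.elim x y))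
  have hlt : ∀ x, φm x < φp x := fun x => by linarith [hsep x]
  have hneg : ∀ f : Rd d → ℝ, Set.range (fun x => -f x) = -Set.range f := fun f => by
    rw [← Set.image_neg_eq_neg, ← Set.range_comp]
    rfl
  have hlap : lapRd (fun x => -φp x) = fun x => -lapRd φp x := funext (lapRd_neg φp)
  obtain ⟨hdm0, hLm0, hm⟩ := hu.lower_growth hmreg hpreg.continuous hmper hd hlt hmaxmin hndm
    hdm hLm
  obtain ⟨hdp0, hLp0, hp⟩ := hu.neg.lower_growth hpreg.neg hmreg.continuous.neg hpper.neg hd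
    (fun x => neg_lt_neg (hlt x))
    (by rw [hneg, hneg, Real.sInf_neg, Real.sSup_neg]; exact neg_lt_neg hmaxmin)
    (fun x hx => by
      rw [hlap] at hx ⊢
      rw [fderiv_fun_neg]
      exact neg_ne_zero.2 (hndp x (neg_eq_zero.1 hx)))
    (D := dp) (L := Lp) (by simpa only [hlap, neg_eq_zero, neg_inj] using hdp)
    (by simpa only [hlap, neg_neg, neg_inj] using hLp)
  refine ⟨hdm0, hdp0, hLm0, hLp0, 2 / min dm dp, by positivity, fun r hr hrC => ?_⟩
  have hrmin : r ≤ min dm dp / 2 := by rwa [one_div_div] at hrC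
  refine ⟨hm r hr (hrmin.trans (by gcongr; exact min_le_left _ _)), fun x hx => ?_⟩
  have := hp r hr (hrmin.trans (by gcongr; exact min_le_right _ _)) x
    (by simpa only [neg_inj] using hx)
  simpa only [neg_sub_neg] using this
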